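/- Suppose σ > 0 is compatible with the partition (‖Ax‖² ≤ σ Σ_{k=1}^K ‖A x_[k]‖² for all x) and F attains its minimum at some α* ∈ ℝ^n. Fix α ∈ ℝ^n, θ ∈ (0,1], and let Δ_[k] be a θ-approximate solution of the k-th local subproblem at α for each k = 1,…,K. Then for every λ ∈ [0,1], F(α + Σ_{k=1}^K Δ_[k]) − F(α*) ≤ (1 − (1−θ)λ)·(F(α) − F(α*)) + (1−θ)·(λ² σ β / 2)·Σ_{k=1}^K ‖A (α* − α)_[k]‖². -/

import Mathlib

open RealInnerProductSpace Finset

noncomputable section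

/-- Matrix–vector product `A x` viewed as a map between Euclidean spaces. -/
def mulVecE {d n : ℕ} (A : Matrix (Fin d) (Fin n) ℝ) (x : EuclideanSpace ℝ (Fin n)) :
    EuclideanSpace ℝ (Fin d) :=
  (WithLp.equiv 2 _).symm (A.mulVec ((WithLp.equiv 2 _) x))

/-- `restr I x` (written `x_[k]` in the paper) equals `x` on the coordinates in `I`
and is zero elsewhere. -/
def restr {n : ℕ} (I : Finset (Fin n)) (x : EuclideanSpace ℝ (Fin n)) :
    EuclideanSpace ℝ (Fin n) :=
  (WithLp.equiv 2 _).symm (fun i => if i ∈ I then x i else 0)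

/-- The global objective `F(α) = f(Aα) + ∑ i g i (α i)`. -/
def objF {d n : ℕ} (A : Matrix (Fin d) (Fin n) ℝ) (f : EuclideanSpace ℝ (Fin d) → ℝ)
    (g : Fin n → ℝ → ℝ) (α : EuclideanSpace ℝ (Fin n)) : ℝ :=
  f (mulVecE A α) + ∑ i, g i (α i)

/-- The CoCoA local subproblem objective
`F_σ^{(k)}(Δ; α, v) = (1/K) f(v) + ⟨∇f(v), AΔ⟩ + (σβ/2)‖AΔ‖² + ∑_{i ∈ I_k} g i (α i + Δ i)`,
where `v = Aα` and `f'` is the gradient of `f`. -/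
def locF {d n : ℕ} (A : Matrix (Fin d) (Fin n) ℝ) (f : EuclideanSpace ℝ (Fin d) → ℝ)
    (f' : EuclideanSpace ℝ (Fin d) → EuclideanSpace ℝ (Fin d))
    (g : Fin n → ℝ → ℝ) (K : ℕ) (σ β : ℝ) (Ik : Finset (Fin n))
    (α Δ : EuclideanSpace ℝ (Fin n)) : ℝ :=
  (1 / (K : ℝ)) * f (mulVecE A α) + ⟪f' (mulVecE A α), mulVecE A Δ⟫
    + σ * β / 2 * ‖mulVecE A Δ‖ ^ 2 + ∑ i ∈ Ik, g i (α i + Δ i)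

/-- Infimum of the local subproblem objective over vectors supported on `Ik`. -/
def locInf {d n : ℕ} (A : Matrix (Fin d) (Fin n) ℝ) (f : EuclideanSpace ℝ (Fin d) → ℝ)
    (f' : EuclideanSpace ℝ (Fin d) → EuclideanSpace ℝ (Fin d))
    (g : Fin n → ℝ → ℝ) (K : ℕ) (σ β : ℝ) (Ik : Finset (Fin n))
    (α : EuclideanSpace ℝ (Fin n)) : ℝ :=
  sInf ((locF A f f' g K σ β Ik α) '' {Δ | ∀ i ∉ Ik, Δ i = 0})

/-- `Δk` is a θ-approximate solution of the `k`-th local subproblem at `α`. -/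
def IsApprox {d n : ℕ} (A : Matrix (Fin d) (Fin n) ℝ) (f : EuclideanSpace ℝ (Fin d) → ℝ)
    (f' : EuclideanSpace ℝ (Fin d) → EuclideanSpace ℝ (Fin d))
    (g : Fin n → ℝ → ℝ) (K : ℕ) (σ β θ : ℝ) (Ik : Finset (Fin n))
    (α Δk : EuclideanSpace ℝ (Fin n)) : Prop :=
  (∀ i ∉ Ik, Δk i = 0) ∧
    locF A f f' g K σ β Ik α Δk - locInf A f f' g K σ β Ik α ≤
      θ * (locF A f f' g K σ β Ik α 0 - locInf A f f' g K σ β Ik α)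

/-- First-order characterization of convexity: the graph lies above each tangent hyperplane. -/
theorem ConvexOn.add_inner_le_of_hasGradientAt {E : Type*} [NormedAddCommGroup E]
    [InnerProductSpace ℝ E] [CompleteSpace E] {f : E → ℝ} {f' u : E}
    (hf : ConvexOn ℝ Set.univ f) (h : HasGradientAt f f' u) (w : E) :
    f u + ⟪f', w - u⟫ ≤ f w := by
  have hconv : ConvexOn ℝ Set.univ (f ∘ AffineMap.lineMap (k := ℝ) u w) :=
    hf.comp_affineMap _
  have hderiv : HasDerivAt (f ∘ AffineMap.lineMap (k := ℝ) u w) ⟪f', w - u⟫ 0 := by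
    have hf' : HasFDerivAt f (InnerProductSpace.toDual ℝ E f')
        (AffineMap.lineMap (k := ℝ) u w 0) := by
      simpa using h.hasFDerivAt
    simpa using hf'.comp_hasDerivAt (0 : ℝ) AffineMap.hasDerivAt_lineMap
  have hslope := hconv.le_slope_of_hasDerivAt (Set.mem_univ _) (Set.mem_univ _) one_pos hderiv
  simp only [slope_def_field, Function.comp_apply, AffineMap.lineMap_apply_zero,
    AffineMap.lineMap_apply_one, sub_zero, div_one] at hslope
  linarith

theorem sum_sum_partition {ι κ M : Type*} [Fintype ι] [Fintype κ] [AddCommMonoid M]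
    {I : κ → Finset ι} (hdisj : ∀ k l, k ≠ l → Disjoint (I k) (I l))
    (hcover : ∀ i, ∃ k, i ∈ I k) (h : ι → M) : ∑ k, ∑ i ∈ I k, h i = ∑ i, h i := by
  classical
  rw [← Finset.sum_biUnion fun k _ l _ hkl => hdisj k l hkl]
  congr 1
  ext i
  simpa using hcover i

theorem mulVecE_eq_toEuclideanLin {d n : ℕ} (A : Matrix (Fin d) (Fin n) ℝ)
    (x : EuclideanSpace ℝ (Fin n)) : mulVecE A x = Matrix.toEuclideanLin A x := rfl

theorem restr_apply {n : ℕ} (I : Finset (Fin n)) (x : EuclideanSpace ℝ (Fin n)) (i : Fin n) :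
    restr I x i = if i ∈ I then x i else 0 := rfl

section Partition

variable {d n K : ℕ} {I : Fin K → Finset (Fin n)}

theorem sum_restr (hdisj : ∀ k l, k ≠ l → Disjoint (I k) (I l)) (hcover : ∀ i, ∃ k, i ∈ I k)
    (x : EuclideanSpace ℝ (Fin n)) : ∑ k, restr (I k) x = x := by
  ext i
  obtain ⟨k, hk⟩ := hcover i
  rw [WithLp.ofLp_sum, Finset.sum_apply, Finset.sum_eq_single k]
  · simp [restr_apply, hk]
  · intro l _ hl
    simp [restr_apply, Finset.disjoint_left.1 (hdisj k l hl.symm) hk]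
  · simp

theorem sum_apply_of_mem (hdisj : ∀ k l, k ≠ l → Disjoint (I k) (I l))
    {Δ : Fin K → EuclideanSpace ℝ (Fin n)} (hΔ : ∀ k, ∀ i ∉ I k, Δ k i = 0)
    {k : Fin K} {i : Fin n} (hi : i ∈ I k) : (∑ l, Δ l) i = Δ k i := by
  rw [WithLp.ofLp_sum, Finset.sum_apply, Finset.sum_eq_single k]
  · intro l _ hl
    exact hΔ l i (Finset.disjoint_left.1 (hdisj k l hl.symm) hi)
  · simp

theorem restr_sum (hdisj : ∀ k l, k ≠ l → Disjoint (I k) (I l))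
    {Δ : Fin K → EuclideanSpace ℝ (Fin n)} (hΔ : ∀ k, ∀ i ∉ I k, Δ k i = 0) (k : Fin K) :
    restr (I k) (∑ l, Δ l) = Δ k := by
  ext i
  rw [restr_apply]
  split_ifs with hi
  · exact sum_apply_of_mem hdisj hΔ hi
  · exact (hΔ k i hi).symm

variable {A : Matrix (Fin d) (Fin n) ℝ} {f : EuclideanSpace ℝ (Fin d) → ℝ}
  {f' : EuclideanSpace ℝ (Fin d) → EuclideanSpace ℝ (Fin d)} {g : Fin n → ℝ → ℝ} {σ β : ℝ}

theorem locF_sub_locF_zero (J : Finset (Fin n)) (α Δ : EuclideanSpace ℝ (Fin n)) :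
    locF A f f' g K σ β J α Δ - locF A f f' g K σ β J α 0 =
      ⟪f' (mulVecE A α), mulVecE A Δ⟫ + σ * β / 2 * ‖mulVecE A Δ‖ ^ 2 +
        ∑ i ∈ J, (g i (α i + Δ i) - g i (α i)) := by
  have h0 : mulVecE A 0 = 0 := by rw [mulVecE_eq_toEuclideanLin, map_zero]
  simp only [locF, h0, Finset.sum_sub_distrib, inner_zero_right, norm_zero, PiLp.zero_apply,
    add_zero]
  ring

theorem objF_add_sum_sub_le (hβ : 0 < β)
    (hsmooth : ∀ u w : EuclideanSpace ℝ (Fin d),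
      f w ≤ f u + ⟪f' u, w - u⟫ + β / 2 * ‖w - u‖ ^ 2)
    (hdisj : ∀ k l, k ≠ l → Disjoint (I k) (I l)) (hcover : ∀ i, ∃ k, i ∈ I k)
    (hcompat : ∀ x : EuclideanSpace ℝ (Fin n),
      ‖mulVecE A x‖ ^ 2 ≤ σ * ∑ k, ‖mulVecE A (restr (I k) x)‖ ^ 2)
    (α : EuclideanSpace ℝ (Fin n)) {Δ : Fin K → EuclideanSpace ℝ (Fin n)}
    (hΔ : ∀ k, ∀ i ∉ I k, Δ k i = 0) :
    objF A f g (α + ∑ k, Δ k) - objF A f g α ≤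
      ∑ k, (locF A f f' g K σ β (I k) α (Δ k) - locF A f f' g K σ β (I k) α 0) := by
  have hg : ∑ k, ∑ i ∈ I k, (g i (α i + Δ k i) - g i (α i)) =
      ∑ i, g i ((α + ∑ k, Δ k) i) - ∑ i, g i (α i) := by
    rw [← Finset.sum_sub_distrib, ← sum_sum_partition hdisj hcover]
    refine Finset.sum_congr rfl fun k _ => Finset.sum_congr rfl fun i hi => ?_
    rw [PiLp.add_apply, sum_apply_of_mem hdisj hΔ hi]
  have hinner : ∑ k, ⟪f' (mulVecE A α), mulVecE A (Δ k)⟫ =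
      ⟪f' (mulVecE A α), mulVecE A (∑ k, Δ k)⟫ := by
    simp only [mulVecE_eq_toEuclideanLin, map_sum, inner_sum]
  have hf := hsmooth (mulVecE A α) (mulVecE A (α + ∑ k, Δ k))
  have hsub : mulVecE A (α + ∑ k, Δ k) - mulVecE A α = mulVecE A (∑ k, Δ k) := by
    rw [mulVecE_eq_toEuclideanLin, map_add]
    exact add_sub_cancel_left _ _
  have hnorm := hcompat (∑ k, Δ k)
  simp only [restr_sum hdisj hΔ] at hnorm
  rw [hsub] at hf
  simp only [locF_sub_locF_zero, Finset.sum_add_distrib, hg, hinner, ← Finset.mul_sum, objF]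
  nlinarith

theorem bddBelow_locF (hβ : 0 < β)
    (hsmooth : ∀ u w : EuclideanSpace ℝ (Fin d),
      f w ≤ f u + ⟪f' u, w - u⟫ + β / 2 * ‖w - u‖ ^ 2)
    (hdisj : ∀ k l, k ≠ l → Disjoint (I k) (I l)) (hcover : ∀ i, ∃ k, i ∈ I k)
    (hcompat : ∀ x : EuclideanSpace ℝ (Fin n),
      ‖mulVecE A x‖ ^ 2 ≤ σ * ∑ k, ‖mulVecE A (restr (I k) x)‖ ^ 2)
    (hbdd : BddBelow (Set.range (objF A f g))) (α : EuclideanSpace ℝ (Fin n)) (k : Fin K) :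
    BddBelow (locF A f f' g K σ β (I k) α '' {Δ | ∀ i ∉ I k, Δ i = 0}) := by
  obtain ⟨m, hm⟩ := hbdd
  refine ⟨m - objF A f g α + locF A f f' g K σ β (I k) α 0, ?_⟩
  rintro _ ⟨x, hx, rfl⟩
  have hsupp : ∀ l, ∀ i ∉ I l, (Pi.single k x : Fin K → EuclideanSpace ℝ (Fin n)) l i = 0 := by
    intro l i hi
    obtain rfl | hl := eq_or_ne l k
    · simpa using hx i hi
    · simp [hl]
  have h := objF_add_sum_sub_le (g := g) hβ hsmooth hdisj hcover hcompat α hsupp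
  rw [Finset.sum_pi_single' k x, if_pos (Finset.mem_univ k),
    Finset.sum_eq_single k (fun l _ hl => by simp [hl]) (by simp), Pi.single_eq_same] at h
  linarith [hm (Set.mem_range_self (α + x))]

theorem IsApprox.locF_sub_le {θ : ℝ} (hθ : θ ≤ 1) {J : Finset (Fin n)}
    {α Δ x : EuclideanSpace ℝ (Fin n)} (h : IsApprox A f f' g K σ β θ J α Δ)
    (hbdd : BddBelow (locF A f f' g K σ β J α '' {Δ | ∀ i ∉ J, Δ i = 0}))
    (hx : ∀ i ∉ J, x i = 0) :
    locF A f f' g K σ β J α Δ - locF A f f' g K σ β J α 0 ≤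
      (1 - θ) * (locF A f f' g K σ β J α x - locF A f f' g K σ β J α 0) := by
  have hinf : locInf A f f' g K σ β J α ≤ locF A f f' g K σ β J α x :=
    csInf_le hbdd ⟨x, hx, rfl⟩
  nlinarith [h.2]

theorem sum_locF_smul_restr_sub_le (hconvf : ConvexOn ℝ Set.univ f)
    (hgrad : ∀ u, HasGradientAt f (f' u) u) (hg : ∀ i, ConvexOn ℝ Set.univ (g i))
    (hdisj : ∀ k l, k ≠ l → Disjoint (I k) (I l)) (hcover : ∀ i, ∃ k, i ∈ I k)
    (α y : EuclideanSpace ℝ (Fin n)) {t : ℝ} (ht : t ∈ Set.Icc (0 : ℝ) 1) :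
    ∑ k, (locF A f f' g K σ β (I k) α (t • restr (I k) (y - α)) -
        locF A f f' g K σ β (I k) α 0) ≤
      t * (objF A f g y - objF A f g α) +
        t ^ 2 * σ * β / 2 * ∑ k, ‖mulVecE A (restr (I k) (y - α))‖ ^ 2 := by
  obtain ⟨ht0, ht1⟩ := ht
  have hsmul (x : EuclideanSpace ℝ (Fin n)) : mulVecE A (t • x) = t • mulVecE A x := by
    simp only [mulVecE_eq_toEuclideanLin, map_smul]
  have hinner : ∑ k, ⟪f' (mulVecE A α), mulVecE A (restr (I k) (y - α))⟫ =
      ⟪f' (mulVecE A α), mulVecE A y - mulVecE A α⟫ := by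
    simp only [mulVecE_eq_toEuclideanLin, ← inner_sum, ← map_sum, ← map_sub,
      sum_restr hdisj hcover]
  have hsum : ∑ k, ∑ i ∈ I k, (g i (α i + (t • restr (I k) (y - α)) i) - g i (α i)) ≤
      t * (∑ i, g i (y i) - ∑ i, g i (α i)) := by
    rw [← Finset.sum_sub_distrib, ← sum_sum_partition hdisj hcover, Finset.mul_sum]
    refine Finset.sum_le_sum fun k _ => ?_
    rw [Finset.mul_sum]
    refine Finset.sum_le_sum fun i hi => ?_
    have h := (hg i).2 (Set.mem_univ (α i)) (Set.mem_univ (y i)) (sub_nonneg.2 ht1) ht0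
      (sub_add_cancel 1 t)
    simp only [smul_eq_mul] at h
    rw [PiLp.smul_apply, restr_apply, if_pos hi, PiLp.sub_apply, smul_eq_mul,
      show α i + t * (y i - α i) = (1 - t) * α i + t * y i by ring]
    linarith
  have hf := mul_le_mul_of_nonneg_left
    (hconvf.add_inner_le_of_hasGradientAt (hgrad (mulVecE A α)) (mulVecE A y)) ht0
  simp only [locF_sub_locF_zero, Finset.sum_add_distrib, hsmul, inner_smul_right, norm_smul,
    mul_pow, Real.norm_eq_abs, sq_abs, ← Finset.mul_sum, hinner, objF]
  linarith

end Partition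

/-- The per-round descent lemma for general convex regularizers: for every
`λ ∈ [0,1]`,
`F(α + ∑ k Δ_[k]) − F(α*) ≤ (1 − (1−θ)λ)(F(α) − F(α*))
   + (1−θ)(λ²σβ/2) ∑ k ‖A(α* − α)_[k]‖²`. -/
theorem stmt_4 {d n K : ℕ} (A : Matrix (Fin d) (Fin n) ℝ)
    (f : EuclideanSpace ℝ (Fin d) → ℝ)
    (f' : EuclideanSpace ℝ (Fin d) → EuclideanSpace ℝ (Fin d))
    (β : ℝ) (hβ : 0 < β)
    (hconvf : ConvexOn ℝ Set.univ f)
    (hgrad : ∀ u, HasGradientAt f (f' u) u)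
    (hsmooth : ∀ u w : EuclideanSpace ℝ (Fin d),
      f w ≤ f u + ⟪f' u, w - u⟫ + β / 2 * ‖w - u‖ ^ 2)
    (g : Fin n → ℝ → ℝ) (hg : ∀ i, ConvexOn ℝ Set.univ (g i))
    (I : Fin K → Finset (Fin n))
    (hne : ∀ k, (I k).Nonempty)
    (hdisj : ∀ k l, k ≠ l → Disjoint (I k) (I l))
    (hcover : ∀ i, ∃ k, i ∈ I k)
    (σ : ℝ) (hσ : 0 < σ)
    (hcompat : ∀ x : EuclideanSpace ℝ (Fin n),
      ‖mulVecE A x‖ ^ 2 ≤ σ * ∑ k, ‖mulVecE A (restr (I k) x)‖ ^ 2)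
    (αstar : EuclideanSpace ℝ (Fin n))
    (hmin : ∀ x : EuclideanSpace ℝ (Fin n), objF A f g αstar ≤ objF A f g x)
    (α : EuclideanSpace ℝ (Fin n)) (θ : ℝ) (hθ : θ ∈ Set.Ioc (0 : ℝ) 1)
    (Δ : Fin K → EuclideanSpace ℝ (Fin n))
    (happrox : ∀ k, IsApprox A f f' g K σ β θ (I k) α (Δ k)) :
    ∀ lam : ℝ, lam ∈ Set.Icc (0 : ℝ) 1 →
      objF A f g (α + ∑ k, Δ k) - objF A f g αstar ≤
        (1 - (1 - θ) * lam) * (objF A f g α - objF A f g αstar) +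
          (1 - θ) * (lam ^ 2 * σ * β / 2) *
            ∑ k, ‖mulVecE A (restr (I k) (αstar - α))‖ ^ 2 := by
  intro lam hlam
  have hbdd : BddBelow (Set.range (objF A f g)) :=
    ⟨objF A f g αstar, Set.forall_mem_range.2 hmin⟩
  have hdescent := objF_add_sum_sub_le (g := g) hβ hsmooth hdisj hcover hcompat α
    fun k => (happrox k).1
  have hlocal := Finset.sum_le_sum fun k (_ : k ∈ Finset.univ) =>
    (happrox k).locF_sub_le hθ.2 (bddBelow_locF hβ hsmooth hdisj hcover hcompat hbdd α k)
      (x := lam • restr (I k) (αstar - α)) fun i hi => by simp [restr_apply, hi]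
  rw [← Finset.mul_sum] at hlocal
  have hstep := mul_le_mul_of_nonneg_left
    (sum_locF_smul_restr_sub_le (A := A) (σ := σ) (β := β) hconvf hgrad hg hdisj hcover α αstar
      hlam) (sub_nonneg.2 hθ.2)
  linarith
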